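/- Let 2 ≤ m ≤ n, and let A be an m×n matrix with nonnegative real entries whose maximum entry is α. Then E(A) ≤ α·(m + √m)·√n / 2. -/

import Mathlib

open Matrix

/-- The singular values of a real `m × n` matrix `A`, listed in decreasing order:
`singularValues A i` is the `i`-th largest square root of an eigenvalue of `A * Aᵀ`
(over `ℝ`, `Aᴴ = Aᵀ`). -/
noncomputable def singularValues {m n : ℕ} (A : Matrix (Fin m) (Fin n) ℝ) : Fin m → ℝ :=
  fun i =>
    Real.sqrt ((Matrix.isHermitian_mul_conjTranspose_self A).eigenvalues
      (Tuple.sort (Matrix.isHermitian_mul_conjTranspose_self A).eigenvalues i.rev))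

/-- The energy of a matrix: the sum of its singular values. -/
noncomputable def energy {m n : ℕ} (A : Matrix (Fin m) (Fin n) ℝ) : ℝ :=
  ∑ i, singularValues A i

/-- The entrywise ℓ¹-norm of a matrix: the sum of the absolute values of its entries. -/
noncomputable def norm1 {m n : ℕ} (A : Matrix (Fin m) (Fin n) ℝ) : ℝ :=
  ∑ i, ∑ j, |A i j|

/-- The energy does not depend on the order in which the singular values are listed. -/
lemma energy_eq_sum_sqrt_eigenvalues {m n : ℕ} (A : Matrix (Fin m) (Fin n) ℝ) :
    energy A =
      ∑ i, Real.sqrt ((Matrix.isHermitian_mul_conjTranspose_self A).eigenvalues i) := by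
  unfold energy singularValues
  exact Equiv.sum_comp
    (Fin.revPerm.trans (Tuple.sort (Matrix.isHermitian_mul_conjTranspose_self A).eigenvalues))
    fun i => Real.sqrt ((Matrix.isHermitian_mul_conjTranspose_self A).eigenvalues i)

/-- Bessel's inequality for a pairwise orthogonal family of vectors of norm at most one. -/
lemma sum_inner_sq_le_of_orthogonal {ι E : Type*} [Fintype ι] [NormedAddCommGroup E]
    [InnerProductSpace ℝ E] (w : ι → E) (horth : ∀ i j, i ≠ j → inner ℝ (w i) (w j) = 0)
    (hnorm : ∀ i, inner ℝ (w i) (w i) ≤ 1) (x : E) :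
    ∑ i, inner ℝ x (w i) ^ 2 ≤ inner ℝ x x := by
  set y : E := ∑ i, inner ℝ x (w i) • w i with hy
  have hxy : inner ℝ x y = ∑ i, inner ℝ x (w i) ^ 2 := by
    simp [hy, inner_sum, inner_smul_right, sq]
  have hyy : inner ℝ y y ≤ ∑ i, inner ℝ x (w i) ^ 2 := by
    have h : ∀ i, inner ℝ (w i) y = inner ℝ x (w i) * inner ℝ (w i) (w i) := by
      intro i
      rw [hy, inner_sum, Finset.sum_eq_single i]
      · rw [inner_smul_right]
      · intro j _ hj
        rw [inner_smul_right, horth i j hj.symm, mul_zero]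
      · simp
    have h2 : inner ℝ y y = ∑ i, inner ℝ x (w i) * inner ℝ (w i) y := by
      conv_lhs => arg 2; rw [hy]
      simp only [sum_inner, inner_smul_left, conj_trivial]
    rw [h2]
    refine Finset.sum_le_sum fun i _ => ?_
    rw [h]
    nlinarith [hnorm i, sq_nonneg (inner ℝ x (w i))]
  have h0 : 0 ≤ inner ℝ (x - y) (x - y) := real_inner_self_nonneg
  rw [real_inner_sub_sub_self] at h0
  linarith

/-- A singular value decomposition: there are an orthonormal basis `v` and an orthogonal family
`w` of vectors of norm at most one such that the energy is the sum of the numbers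
`⟪Aᵀ v i, w i⟫`. -/
lemma exists_energy_eq_sum_inner {m n : ℕ} (A : Matrix (Fin m) (Fin n) ℝ) :
    ∃ (v : OrthonormalBasis (Fin m) ℝ (EuclideanSpace ℝ (Fin m)))
      (w : Fin m → EuclideanSpace ℝ (Fin n)),
      (∀ i j, i ≠ j → inner ℝ (w i) (w j) = 0) ∧ (∀ i, inner ℝ (w i) (w i) ≤ 1) ∧
      energy A = ∑ i, ∑ j, (∑ k, A k j * v i k) * w i j := by
  set hA := Matrix.isHermitian_mul_conjTranspose_self A
  set v := hA.eigenvectorBasis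
  set u : Fin m → EuclideanSpace ℝ (Fin n) := fun i => WithLp.toLp 2 (Aᵀ *ᵥ (v i).ofLp) with hu
  have huu : ∀ i j, inner ℝ (u i) (u j) = if i = j then hA.eigenvalues i else 0 := by
    intro i j
    have h1 : inner ℝ (u i) (u j) = inner ℝ (v i) (WithLp.toLp 2 ((A * Aᴴ) *ᵥ (v j).ofLp)) := by
      simp only [hu, EuclideanSpace.inner_eq_star_dotProduct, star_trivial,
        conjTranspose_eq_transpose_of_trivial]
      rw [← Matrix.mulVec_mulVec, Matrix.dotProduct_mulVec, Matrix.vecMul_transpose,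
        dotProduct_comm (A *ᵥ _) _]
    rw [h1, hA.mulVec_eigenvectorBasis j]
    rw [WithLp.toLp_smul, inner_smul_right, WithLp.toLp_ofLp,
      orthonormal_iff_ite.mp v.orthonormal i j]
    split_ifs with h <;> simp [h]
  have hnonneg : ∀ i, 0 ≤ hA.eigenvalues i := fun i => by
    have h := real_inner_self_nonneg (x := u i)
    rwa [huu, if_pos rfl] at h
  refine ⟨v, fun i => (Real.sqrt (hA.eigenvalues i))⁻¹ • u i, ?_, ?_, ?_⟩
  · intro i j hij
    simp [inner_smul_left, inner_smul_right, huu, hij]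
  · intro i
    simp only [inner_smul_left, inner_smul_right, huu, if_true]
    rcases (hnonneg i).eq_or_lt with h | h
    · rw [← h]
      simp
    · have hs := Real.sqrt_pos.mpr h
      apply le_of_eq
      simp only [map_inv₀, conj_trivial]
      field_simp
      rw [Real.sq_sqrt h.le]
  · rw [energy_eq_sum_sqrt_eigenvalues]
    refine Finset.sum_congr rfl fun i _ => ?_
    have h1 : ∑ j, (∑ k, A k j * v i k) * ((Real.sqrt (hA.eigenvalues i))⁻¹ • u i) j
        = (Real.sqrt (hA.eigenvalues i))⁻¹ * inner ℝ (u i) (u i) := by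
      rw [PiLp.inner_apply, Finset.mul_sum]
      refine Finset.sum_congr rfl fun j _ => ?_
      simp [hu, Matrix.mulVec, dotProduct]
      ring
    rw [h1, huu, if_pos rfl, inv_mul_eq_div, Real.div_sqrt]

/-- If every entry of `A` is within `r` of `r`, then the energy of `A` is at most the energy
`r √m √n` of the constant matrix `r` plus the bound `r m √n` for the difference. -/
lemma energy_le_of_abs_sub_le {m n : ℕ} (A : Matrix (Fin m) (Fin n) ℝ) {r : ℝ} (hr : 0 ≤ r)
    (h : ∀ i j, |A i j - r| ≤ r) :
    energy A ≤ r * ((m : ℝ) + Real.sqrt m) * Real.sqrt n := by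
  obtain ⟨v, w, horth, hnorm, hE⟩ := exists_energy_eq_sum_inner A
  set b : Fin n → EuclideanSpace ℝ (Fin m) := fun j => WithLp.toLp 2 fun k => A k j - r with hb
  set e : EuclideanSpace ℝ (Fin m) := WithLp.toLp 2 fun _ => 1 with he
  set f : EuclideanSpace ℝ (Fin n) := WithLp.toLp 2 fun _ => 1 with hf
  have hsplit : energy A = ∑ p : Fin m × Fin n, inner ℝ (v p.1) (b p.2) * w p.1 p.2
      + r * ∑ i, inner ℝ (v i) e * inner ℝ f (w i) := by
    rw [hE, Fintype.sum_prod_type, Finset.mul_sum, ← Finset.sum_add_distrib]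
    refine Finset.sum_congr rfl fun i _ => ?_
    have hfw : inner ℝ f (w i) = ∑ j, w i j := by simp [hf, PiLp.inner_apply]
    rw [hfw, Finset.mul_sum, Finset.mul_sum, ← Finset.sum_add_distrib]
    refine Finset.sum_congr rfl fun j _ => ?_
    have hcol : ∑ k, A k j * v i k = inner ℝ (v i) (b j) + r * inner ℝ (v i) e := by
      simp only [hb, he, PiLp.inner_apply, Finset.mul_sum, ← Finset.sum_add_distrib]
      refine Finset.sum_congr rfl fun k _ => ?_
      simp
      ring
    rw [hcol]
    ring
  have parseval : ∀ x, ∑ i, inner ℝ (v i) x ^ 2 = inner ℝ x x := by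
    intro x
    simpa [real_inner_self_eq_norm_sq] using v.sum_sq_norm_inner_right x
  have hee : inner ℝ e e = (m : ℝ) := by
    simp [he, EuclideanSpace.inner_eq_star_dotProduct, dotProduct,
      -inner_self_eq_norm_sq_to_K]
  have hff : inner ℝ f f = (n : ℝ) := by
    simp [hf, EuclideanSpace.inner_eq_star_dotProduct, dotProduct,
      -inner_self_eq_norm_sq_to_K]
  have hbb : ∑ p : Fin m × Fin n, inner ℝ (v p.1) (b p.2) ^ 2 ≤ r ^ 2 * m * n := by
    rw [Fintype.sum_prod_type_right]
    have hj : ∀ j, ∑ i, inner ℝ (v i) (b j) ^ 2 ≤ m * r ^ 2 := by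
      intro j
      rw [parseval, PiLp.inner_apply]
      refine (Finset.sum_le_card_nsmul _ _ (r ^ 2) fun k _ => ?_).trans_eq (by simp)
      have := sq_le_sq.mpr ((h k j).trans (le_abs_self r))
      simpa [hb, sq] using this
    refine (Finset.sum_le_card_nsmul _ _ _ fun j _ => hj j).trans_eq ?_
    simp
    ring
  have hww : ∑ p : Fin m × Fin n, w p.1 p.2 ^ 2 ≤ m := by
    rw [Fintype.sum_prod_type]
    refine (Finset.sum_le_card_nsmul _ _ 1 fun i _ => ?_).trans_eq (by simp)
    have hi := hnorm i
    rw [PiLp.inner_apply] at hi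
    simpa [sq] using hi
  have h1 : ∑ p : Fin m × Fin n, inner ℝ (v p.1) (b p.2) * w p.1 p.2 ≤ r * m * Real.sqrt n := by
    refine (Real.sum_mul_le_sqrt_mul_sqrt _ _ _).trans ?_
    calc _ ≤ Real.sqrt (r ^ 2 * m * n) * Real.sqrt m := by gcongr
      _ = r * (Real.sqrt m * Real.sqrt m) * Real.sqrt n := by
        rw [Real.sqrt_mul (by positivity), Real.sqrt_mul (by positivity), Real.sqrt_sq hr]
        ring
      _ = _ := by rw [Real.mul_self_sqrt (Nat.cast_nonneg m)]
  have h2 : ∑ i, inner ℝ (v i) e * inner ℝ f (w i) ≤ Real.sqrt m * Real.sqrt n := by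
    refine (Real.sum_mul_le_sqrt_mul_sqrt _ _ _).trans ?_
    rw [parseval, hee, ← hff]
    gcongr
    exact sum_inner_sq_le_of_orthogonal w horth hnorm f
  rw [hsplit]
  nlinarith [mul_le_mul_of_nonneg_left h2 hr]

/-- Theorem 2 of the paper. If `2 ≤ m ≤ n` and `A` is an `m × n`
nonnegative real matrix with maximum entry `α`, then `E(A) ≤ α·(m + √m)·√n / 2`. -/
theorem energy_le_absolute_bound {m n : ℕ} (hm : 2 ≤ m) (hmn : m ≤ n)
    (A : Matrix (Fin m) (Fin n) ℝ) (α : ℝ)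
    (hnonneg : ∀ i j, 0 ≤ A i j) (hmax_le : ∀ i j, A i j ≤ α)
    (hmax_ex : ∃ i j, A i j = α) :
    energy A ≤ α * ((m : ℝ) + Real.sqrt m) * Real.sqrt n / 2 := by
  obtain ⟨i₀, j₀, h₀⟩ := hmax_ex
  have hα : 0 ≤ α := h₀ ▸ hnonneg i₀ j₀
  have h := energy_le_of_abs_sub_le A (r := α / 2) (by linarith) fun i j =>
    abs_le.mpr ⟨by linarith [hnonneg i j], by linarith [hmax_le i j]⟩
  linarith
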